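/- arXiv:1605.00368 — 4 statements merged into one kernel-verified Lean document; each statement's English description precedes it below -/
import Mathlib

section
/- Let X be a set, let V be a linear subspace of the space of real-valued functions on X, and let L : V → ℝ be a linear functional such that L(v) ≥ 0 whenever v ∈ V is pointwise nonnegative on X. Let g : X → ℝ with g ∉ V be such that there exist f₁, f₂ ∈ V with f₁ ≤ g ≤ f₂ pointwise, and let e ∈ ℝ satisfy sup{ L(f) : f ∈ V, f ≤ g pointwise } ≤ e ≤ inf{ L(f) : f ∈ V, g ≤ f pointwise }. Then the linear functional L̄ on the subspace V ⊕ ℝg defined by L̄(f + d·g) = L(f) + d·e (for f ∈ V, d ∈ ℝ) is well-defined, extends L, and is positive: L̄(h) ≥ 0 for every h ∈ V ⊕ ℝg that is pointwise nonnegative on X. -/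
/-- Positivity of a linear functional on `V` gives monotonicity. -/
theorem apply_le_apply_of_pointwise_le {X : Type*} {V : Submodule ℝ (X → ℝ)} {L : V →ₗ[ℝ] ℝ}
    (hL : ∀ v : V, (∀ x : X, 0 ≤ (v : X → ℝ) x) → 0 ≤ L v) {u v : V}
    (huv : ∀ x : X, (u : X → ℝ) x ≤ (v : X → ℝ) x) : L u ≤ L v := by
  have h := hL (v - u) fun x => sub_nonneg.2 (huv x)
  rwa [map_sub, sub_nonneg] at h

/-- Given a positive linear functional `L` on a subspace `V` of
real-valued functions on `X`, a function `g ∉ V` squeezed between two elements of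
`V`, and a real `e` with `sup {L f : f ≤ g} ≤ e ≤ inf {L f : g ≤ f}`, the map
`L̄(f + d • g) = L f + d * e` is a well-defined positive linear functional on
`V ⊕ ℝg` extending `L`. -/
theorem stmt_4 (X : Type*) (V : Submodule ℝ (X → ℝ)) (L : V →ₗ[ℝ] ℝ)
    (hL : ∀ v : V, (∀ x : X, 0 ≤ (v : X → ℝ) x) → 0 ≤ L v)
    (g : X → ℝ) (hg : g ∉ V)
    (f₁ f₂ : V) (h₁ : ∀ x : X, (f₁ : X → ℝ) x ≤ g x)
    (h₂ : ∀ x : X, g x ≤ (f₂ : X → ℝ) x)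
    (e : ℝ)
    (he₁ : sSup {r : ℝ | ∃ f : V, (∀ x : X, (f : X → ℝ) x ≤ g x) ∧ L f = r} ≤ e)
    (he₂ : e ≤ sInf {r : ℝ | ∃ f : V, (∀ x : X, g x ≤ (f : X → ℝ) x) ∧ L f = r}) :
    ∃ L' : ↥(V ⊔ Submodule.span ℝ {g}) →ₗ[ℝ] ℝ,
      (∀ (f : X → ℝ) (hf : f ∈ V) (d : ℝ),
        L' ⟨f + d • g,
          Submodule.add_mem _ (Submodule.mem_sup_left hf)
            (Submodule.smul_mem _ d
              (Submodule.mem_sup_right (Submodule.mem_span_singleton_self g)))⟩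
          = L ⟨f, hf⟩ + d * e) ∧
      (∀ h : ↥(V ⊔ Submodule.span ℝ {g}),
        (∀ x : X, 0 ≤ (h : X → ℝ) x) → 0 ≤ L' h) := by
  have lower : ∀ f : V, (∀ x, (f : X → ℝ) x ≤ g x) → L f ≤ e := fun f hf =>
    he₁.trans' (le_csSup ⟨L f₂, by
      rintro _ ⟨u, hu, rfl⟩
      exact apply_le_apply_of_pointwise_le hL fun x => (hu x).trans (h₂ x)⟩ ⟨f, hf, rfl⟩)
  have upper : ∀ f : V, (∀ x, g x ≤ (f : X → ℝ) x) → e ≤ L f := fun f hf =>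
    he₂.trans (csInf_le ⟨L f₁, by
      rintro _ ⟨u, hu, rfl⟩
      exact apply_le_apply_of_pointwise_le hL fun x => (h₁ x).trans (hu x)⟩ ⟨f, hf, rfl⟩)
  obtain ⟨L', hL'⟩ : ∃ L' : ↥(V ⊔ Submodule.span ℝ {g}) →ₗ[ℝ] ℝ,
      ∀ (f : X → ℝ) (hf : f ∈ V) (d : ℝ) (hfd : f + d • g ∈ V ⊔ Submodule.span ℝ {g}),
        L' ⟨f + d • g, hfd⟩ = L ⟨f, hf⟩ + d * e :=
    let F : (X → ℝ) →ₗ.[ℝ] ℝ := ⟨V, L⟩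
    ⟨(F.supSpanSingleton g e hg).toFun,
      fun f hf d _ => F.supSpanSingleton_apply_mk g e hg f hf d⟩
  refine ⟨L', fun f hf d => hL' f hf d _, ?_⟩
  rintro ⟨h, hh⟩ hpos
  obtain ⟨f, hf, _, hw, rfl⟩ := Submodule.mem_sup.1 hh
  obtain ⟨d, rfl⟩ := Submodule.mem_span_singleton.1 hw
  rw [hL' f hf d hh]
  replace hpos : ∀ x, 0 ≤ f x + d * g x := hpos
  rcases lt_trichotomy d 0 with hd | rfl | hd
  · have key := upper ((-d⁻¹) • ⟨f, hf⟩) fun x => by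
      change g x ≤ -d⁻¹ * f x
      have hx := mul_nonneg (neg_nonneg.2 (inv_lt_zero.2 hd).le) (hpos x)
      have : -d⁻¹ * (f x + d * g x) = -d⁻¹ * f x - g x := by field_simp [hd.ne]; ring
      linarith
    rw [map_smul, smul_eq_mul] at key
    have hmul := mul_le_mul_of_nonpos_left key hd.le
    have : d * (-d⁻¹ * L ⟨f, hf⟩) = -L ⟨f, hf⟩ := by field_simp [hd.ne]
    linarith
  · simpa using hL ⟨f, hf⟩ fun x => by simpa using hpos x
  · have key := lower ((-d⁻¹) • ⟨f, hf⟩) fun x => by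
      change -d⁻¹ * f x ≤ g x
      have hx := mul_nonneg (inv_pos.2 hd).le (hpos x)
      have : d⁻¹ * (f x + d * g x) = d⁻¹ * f x + g x := by field_simp [hd.ne']
      linarith
    rw [map_smul, smul_eq_mul] at key
    have hmul := mul_le_mul_of_nonneg_left key hd.le
    have : d * (-d⁻¹ * L ⟨f, hf⟩) = -L ⟨f, hf⟩ := by field_simp [hd.ne']
    linarith
end

section
/- (Main extension theorem.) Let n be a natural number, let X be a subset of ℝⁿ (with the subspace topology), and let 𝒜 be a subalgebra of C(X, ℝ) containing the constant function 1. Let L : 𝒜 → ℝ be a linear functional satisfying L(a) ≥ 0 for every a ∈ 𝒜 with a(x) ≥ 0 for all x ∈ X. Define C'(X) := { f ∈ C(X, ℝ) : there exists a ∈ 𝒜 with |f(x)| ≤ |a(x)| for all x ∈ X }. Then there exists a linear functional L' : C'(X) → ℝ such that L'(a) = L(a) for all a ∈ 𝒜, and L'(f) ≥ 0 for every f ∈ C'(X) with f(x) ≥ 0 for all x ∈ X. Moreover 𝒜 ∪ C_c(X) ⊆ C'(X). -/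
set_option synthInstance.maxHeartbeats 400000
set_option maxHeartbeats 800000

section PositiveExtension

variable {X : Type*} [TopologicalSpace X]

/-- The continuous functions dominated in absolute value by an element of a subalgebra. -/
def Subalgebra.dominated (𝒜 : Subalgebra ℝ C(X, ℝ)) : Submodule ℝ C(X, ℝ) where
  carrier := {f | ∃ a ∈ 𝒜, ∀ x, |f x| ≤ |a x|}
  zero_mem' := ⟨0, 𝒜.zero_mem, fun _ => le_rfl⟩
  add_mem' := by
    rintro f g ⟨a, ha, hfa⟩ ⟨b, hb, hgb⟩
    refine ⟨1 + (1 + (a * a + b * b)), add_mem 𝒜.one_mem (add_mem 𝒜.one_mem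
      (add_mem (mul_mem ha ha) (mul_mem hb hb))), fun x => ?_⟩
    simp only [ContinuousMap.add_apply, ContinuousMap.mul_apply, ContinuousMap.one_apply]
    refine le_trans ?_ (le_abs_self _)
    have := abs_add_le (f x) (g x)
    nlinarith [hfa x, hgb x, sq_nonneg (|a x| - 1), sq_nonneg (|b x| - 1),
      abs_mul_abs_self (a x), abs_mul_abs_self (b x)]
  smul_mem' := by
    rintro c f ⟨a, ha, hfa⟩
    refine ⟨c • a, 𝒜.smul_mem ha c, fun x => ?_⟩
    simpa only [ContinuousMap.smul_apply, smul_eq_mul, abs_mul] using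
      mul_le_mul_of_nonneg_left (hfa x) (abs_nonneg c)

theorem Subalgebra.mem_dominated_of_mem {𝒜 : Subalgebra ℝ C(X, ℝ)} {f : C(X, ℝ)}
    (hf : f ∈ 𝒜) : f ∈ 𝒜.dominated :=
  ⟨f, hf, fun _ => le_rfl⟩

theorem Subalgebra.mem_dominated_of_hasCompactSupport (𝒜 : Subalgebra ℝ C(X, ℝ))
    {f : C(X, ℝ)} (hf : HasCompactSupport f) : f ∈ 𝒜.dominated := by
  obtain ⟨M, hM⟩ := hf.exists_bound_of_continuous f.continuous
  exact ⟨algebraMap ℝ C(X, ℝ) M, 𝒜.algebraMap_mem M, fun x => (hM x).trans (le_abs_self M)⟩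

/-- A positive linear functional on a subalgebra of `C(X, ℝ)` extends to a linear functional that
is positive on the functions dominated by the subalgebra. -/
theorem Subalgebra.exists_extension_nonneg_on_dominated (𝒜 : Subalgebra ℝ C(X, ℝ))
    (L : 𝒜 →ₗ[ℝ] ℝ) (hL : ∀ a : 𝒜, (∀ x, 0 ≤ (a : C(X, ℝ)) x) → 0 ≤ L a) :
    ∃ L' : C(X, ℝ) →ₗ[ℝ] ℝ, (∀ a : 𝒜, L' a = L a) ∧
      ∀ f ∈ 𝒜.dominated, (∀ x, 0 ≤ f x) → 0 ≤ L' f := by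
  let s : PointedCone ℝ 𝒜.dominated :=
    { carrier := {f | ∀ x, 0 ≤ (f : C(X, ℝ)) x}
      zero_mem' := fun _ => le_rfl
      add_mem' := fun hf hg x => add_nonneg (hf x) (hg x)
      smul_mem' := fun c _ hf x => mul_nonneg c.2 (hf x) }
  let p : 𝒜.dominated →ₗ.[ℝ] ℝ :=
    { domain := (Subalgebra.toSubmodule 𝒜).comap 𝒜.dominated.subtype
      toFun :=
        { toFun := fun f => L ⟨f.1.1, f.2⟩
          map_add' := fun f g => L.map_add ⟨f.1.1, f.2⟩ ⟨g.1.1, g.2⟩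
          map_smul' := fun c f => L.map_smul c ⟨f.1.1, f.2⟩ } }
  obtain ⟨g, hgp, hgs⟩ := riesz_extension s p (fun f hf => hL ⟨f.1.1, f.2⟩ hf) (by
    rintro ⟨f, a, ha, hfa⟩
    have hb : 1 + a * a ∈ 𝒜 := add_mem 𝒜.one_mem (mul_mem ha ha)
    refine ⟨⟨⟨1 + a * a, mem_dominated_of_mem hb⟩, hb⟩, fun x => ?_⟩
    change 0 ≤ 1 + a x * a x + f x
    nlinarith [hfa x, neg_abs_le (f x), sq_nonneg (|a x| - 1), abs_mul_abs_self (a x)])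
  obtain ⟨L', hL'⟩ := g.exists_extend
  have hL'g (f : 𝒜.dominated) : L' f = g f := LinearMap.congr_fun hL' f
  refine ⟨L', fun a => ?_, fun f hf hf0 => ?_⟩
  · exact (hL'g ⟨a, mem_dominated_of_mem a.2⟩).trans
      (hgp ⟨⟨a, mem_dominated_of_mem a.2⟩, a.2⟩)
  · exact (hgs ⟨f, hf⟩ hf0).trans_eq (hL'g ⟨f, hf⟩).symm

end PositiveExtension

/-- Main extension theorem: Let `X ⊆ ℝⁿ`, let `𝒜` be a subalgebra
of `C(X, ℝ)` containing `1`, and let `L : 𝒜 → ℝ` be a positive linear functional.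
With `C'(X) = {f ∈ C(X,ℝ) : ∃ a ∈ 𝒜, |f| ≤ |a| pointwise}`, there exists a
linear functional `L'` on `C'(X)` extending `L` and positive on `C'(X)`;
moreover `𝒜 ∪ C_c(X) ⊆ C'(X)`. -/
theorem stmt_5 (n : ℕ) (X : Set (EuclideanSpace ℝ (Fin n)))
    (𝒜 : Subalgebra ℝ C(X, ℝ)) (L : 𝒜 →ₗ[ℝ] ℝ)
    (hL : ∀ a : 𝒜, (∀ x : X, 0 ≤ (a : C(X, ℝ)) x) → 0 ≤ L a) :
    let C' : Set C(X, ℝ) := {f | ∃ a ∈ 𝒜, ∀ x : X, |f x| ≤ |a x|}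
    (∃ L' : C(X, ℝ) → ℝ,
      (∀ f ∈ C', ∀ g ∈ C', L' (f + g) = L' f + L' g) ∧
      (∀ (c : ℝ), ∀ f ∈ C', L' (c • f) = c * L' f) ∧
      (∀ a : 𝒜, L' (a : C(X, ℝ)) = L a) ∧
      (∀ f ∈ C', (∀ x : X, 0 ≤ f x) → 0 ≤ L' f)) ∧
    (𝒜 : Set C(X, ℝ)) ∪ {f : C(X, ℝ) | HasCompactSupport f} ⊆ C' := by
  intro C'
  obtain ⟨L', hL'L, hL'⟩ := 𝒜.exists_extension_nonneg_on_dominated L hL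
  refine ⟨⟨L', fun f _ g _ => map_add L' f g, fun c f _ => map_smul L' c f, hL'L, hL'⟩, ?_⟩
  rintro f (hf | hf)
  · exact Subalgebra.mem_dominated_of_mem hf
  · exact 𝒜.mem_dominated_of_hasCompactSupport hf
end

section
/- Let L : ℝ[x] → ℝ be a linear functional on the ring of real polynomials in one variable such that L(f) ≥ 0 for every f ∈ ℝ[x] with f(a) ≥ 0 for all a ∈ ℝ. Then there exists a Borel measure μ on ℝ such that for every n ∈ ℕ, the function x ↦ xⁿ is μ-integrable and L(xⁿ) = ∫_ℝ xⁿ dμ(x); consequently L(f) = ∫_ℝ f(x) dμ(x) for every f ∈ ℝ[x]. -/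
open MeasureTheory

open Filter Topology Polynomial CompactlySupported

/-- The trapezoidal cutoff: equal to `1` on `[-n, n]` and to `0` outside `(-(n+1), n+1)`. -/
noncomputable def trapezoid (n : ℕ) (x : ℝ) : ℝ := max 0 (min 1 (n + 1 - |x|))

lemma trapezoid_nonneg (n : ℕ) (x : ℝ) : 0 ≤ trapezoid n x := le_max_left _ _

lemma trapezoid_le_one (n : ℕ) (x : ℝ) : trapezoid n x ≤ 1 :=
  max_le zero_le_one (min_le_left _ _)

lemma trapezoid_eq_one {n : ℕ} {x : ℝ} (h : |x| ≤ n) : trapezoid n x = 1 := by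
  rw [trapezoid, min_eq_left (by linarith), max_eq_right zero_le_one]

lemma trapezoid_eq_zero {n : ℕ} {x : ℝ} (h : (n : ℝ) + 1 ≤ |x|) : trapezoid n x = 0 :=
  max_eq_left ((min_le_right _ _).trans (by linarith))

lemma continuous_trapezoid (n : ℕ) : Continuous (trapezoid n) := by
  unfold trapezoid
  fun_prop

lemma tendsto_trapezoid (x : ℝ) : Tendsto (fun n => trapezoid n x) atTop (𝓝 1) := by
  obtain ⟨N, hN⟩ := exists_nat_ge |x|
  refine tendsto_const_nhds.congr' ?_
  filter_upwards [eventually_ge_atTop N] with n hn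
  exact (trapezoid_eq_one (hN.trans (by exact_mod_cast hn))).symm

/-- A polynomial function multiplied by the trapezoidal cutoff. -/
noncomputable def truncatedPolynomial (p : ℝ[X]) (n : ℕ) : C_c(ℝ, ℝ) where
  toFun x := trapezoid n x * p.eval x
  continuous_toFun := (continuous_trapezoid n).mul p.continuous
  hasCompactSupport' := by
    refine HasCompactSupport.of_support_subset_isCompact
      (isCompact_Icc (a := -((n : ℝ) + 1)) (b := (n : ℝ) + 1)) fun x hx => ?_
    by_contra h
    refine hx ?_
    have h' : (n : ℝ) + 1 ≤ |x| := by
      by_contra h'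
      exact h (abs_le.mp (not_le.mp h').le)
    simp [trapezoid_eq_zero h']

lemma truncatedPolynomial_apply (p : ℝ[X]) (n : ℕ) (x : ℝ) :
    truncatedPolynomial p n x = trapezoid n x * p.eval x := rfl

lemma tendsto_truncatedPolynomial (p : ℝ[X]) (x : ℝ) :
    Tendsto (fun n => truncatedPolynomial p n x) atTop (𝓝 (p.eval x)) := by
  simpa [truncatedPolynomial_apply] using (tendsto_trapezoid x).mul_const (p.eval x)

lemma norm_truncatedPolynomial_le (p : ℝ[X]) (n : ℕ) (x : ℝ) :
    ‖truncatedPolynomial p n x‖ ≤ ‖p.eval x‖ := by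
  rw [truncatedPolynomial_apply, norm_mul, Real.norm_of_nonneg (trapezoid_nonneg n x)]
  exact mul_le_of_le_one_left (norm_nonneg _) (trapezoid_le_one n x)

/-- The error made by truncating at `n` is controlled by `1 / n` times a fixed polynomial. -/
lemma eval_le_truncatedPolynomial_add (p : ℝ[X]) {n : ℕ} (hn : 0 < n) (x : ℝ) :
    p.eval x ≤ truncatedPolynomial p n x + (n : ℝ)⁻¹ * (x ^ 2 + p.eval x ^ 2) := by
  have hn' : (0 : ℝ) < n := by exact_mod_cast hn
  rw [truncatedPolynomial_apply]
  rcases le_total |x| n with h | h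
  · rw [trapezoid_eq_one h, one_mul]
    have : 0 ≤ (n : ℝ)⁻¹ * (x ^ 2 + p.eval x ^ 2) := by positivity
    linarith
  · have h1 : (1 - trapezoid n x) * p.eval x ≤ |p.eval x| :=
      calc (1 - trapezoid n x) * p.eval x
          ≤ (1 - trapezoid n x) * |p.eval x| :=
            mul_le_mul_of_nonneg_left (le_abs_self _) (sub_nonneg.2 (trapezoid_le_one n x))
        _ ≤ |p.eval x| :=
            mul_le_of_le_one_left (abs_nonneg _) (by linarith [trapezoid_nonneg n x])
    have h2 : |p.eval x| ≤ (n : ℝ)⁻¹ * (x ^ 2 + p.eval x ^ 2) := by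
      rw [inv_mul_eq_div, le_div_iff₀ hn', ← sq_abs x, ← sq_abs (p.eval x)]
      nlinarith [sq_nonneg (|x| - |p.eval x|), abs_nonneg x, abs_nonneg (p.eval x)]
    linarith

/-- A functional on polynomials that is nonnegative on nonnegative polynomials extends to a
functional on sums of compactly supported continuous functions and polynomials, with the same
positivity. -/
lemma exists_positive_extension (L : ℝ[X] →ₗ[ℝ] ℝ)
    (hL : ∀ f : ℝ[X], (∀ a : ℝ, 0 ≤ f.eval a) → 0 ≤ L f) :
    ∃ Λ : C_c(ℝ, ℝ) →ₗ[ℝ] ℝ,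
      ∀ (g : C_c(ℝ, ℝ)) (p : ℝ[X]), (∀ x, 0 ≤ g x + p.eval x) → 0 ≤ Λ g + L p := by
  let s : PointedCone ℝ (C_c(ℝ, ℝ) × ℝ[X]) :=
    { carrier := {v | ∀ x, 0 ≤ v.1 x + v.2.eval x}
      zero_mem' := by simp
      smul_mem' := fun c v hv x => by
        have := mul_nonneg c.2 (hv x)
        simpa only [mul_add, Prod.smul_fst, Prod.smul_snd, eval_smul] using! this
      add_mem' := fun {v w} hv hw x => by
        have := add_nonneg (hv x) (hw x)
        simp only [Prod.fst_add, Prod.snd_add, CompactlySupportedContinuousMap.add_apply,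
          eval_add]
        linarith }
  let f : C_c(ℝ, ℝ) × ℝ[X] →ₗ.[ℝ] ℝ :=
    ⟨LinearMap.ker (LinearMap.fst ℝ _ _), (L ∘ₗ LinearMap.snd ℝ _ _).domRestrict _⟩
  obtain ⟨Φ, hΦ, hpos⟩ := riesz_extension s f
    (by
      rintro ⟨⟨g, p⟩, hg : g = 0⟩ hv
      subst hg
      exact hL p fun a => by simpa using! hv a)
    (by
      rintro ⟨g, p⟩
      obtain ⟨c, hc⟩ := g.hasCompactSupport.exists_bound_of_continuous g.continuous
      refine ⟨⟨(0, C c - p), rfl⟩, fun x => ?_⟩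
      have := neg_le_of_abs_le (hc x)
      simp
      linarith)
  refine ⟨Φ ∘ₗ LinearMap.inl ℝ _ _, fun g p h => ?_⟩
  have h1 : Φ (0, p) = L p := hΦ ⟨(0, p), rfl⟩
  have h2 := hpos (g, p) h
  rw [← h1]
  simpa [← map_add] using h2

lemma integrable_eval_of_forall_nonneg {L : ℝ[X] →ₗ[ℝ] ℝ} {Λ : C_c(ℝ, ℝ) →ₗ[ℝ] ℝ}
    (hΛ : ∀ (g : C_c(ℝ, ℝ)) (p : ℝ[X]), (∀ x, 0 ≤ g x + p.eval x) → 0 ≤ Λ g + L p)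
    {μ : Measure ℝ} [IsFiniteMeasureOnCompacts μ] (hμ : ∀ g : C_c(ℝ, ℝ), ∫ x, g x ∂μ = Λ g)
    {p : ℝ[X]} (hp : ∀ x, 0 ≤ p.eval x) : Integrable (fun x => p.eval x) μ := by
  have hbound (n : ℕ) : ∫⁻ x, ‖truncatedPolynomial p n x‖ₑ ∂μ ≤ ENNReal.ofReal (L p) := by
    have hnn (x : ℝ) : 0 ≤ truncatedPolynomial p n x :=
      mul_nonneg (trapezoid_nonneg n x) (hp x)
    have hle : Λ (truncatedPolynomial p n) ≤ L p := by
      have := hΛ (-truncatedPolynomial p n) p fun x => by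
        have := mul_le_of_le_one_left (hp x) (trapezoid_le_one n x)
        simpa [truncatedPolynomial_apply] using this
      rw [map_neg] at this
      linarith
    have hi : Integrable (truncatedPolynomial p n) μ := (truncatedPolynomial p n).integrable
    rw [← ofReal_integral_norm_eq_lintegral_enorm hi]
    simp_rw [Real.norm_of_nonneg (hnn _)]
    rw [hμ]
    exact ENNReal.ofReal_le_ofReal hle
  exact integrable_of_tendsto (Eventually.of_forall (tendsto_truncatedPolynomial p))
    (fun n => (truncatedPolynomial p n).continuous.aestronglyMeasurable)
    (ne_top_of_le_ne_top ENNReal.ofReal_ne_top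
      ((liminf_le_liminf (Eventually.of_forall hbound)).trans (liminf_const _).le))

lemma integrable_eval {L : ℝ[X] →ₗ[ℝ] ℝ} {Λ : C_c(ℝ, ℝ) →ₗ[ℝ] ℝ}
    (hΛ : ∀ (g : C_c(ℝ, ℝ)) (p : ℝ[X]), (∀ x, 0 ≤ g x + p.eval x) → 0 ≤ Λ g + L p)
    {μ : Measure ℝ} [IsFiniteMeasureOnCompacts μ] (hμ : ∀ g : C_c(ℝ, ℝ), ∫ x, g x ∂μ = Λ g)
    (p : ℝ[X]) : Integrable (fun x => p.eval x) μ := by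
  have h : Integrable (fun x => (1 + p ^ 2).eval x) μ :=
    integrable_eval_of_forall_nonneg hΛ hμ fun x => by
      simp only [eval_add, eval_one, eval_pow]
      positivity
  refine h.mono' p.continuous.aestronglyMeasurable (Eventually.of_forall fun x => ?_)
  simp only [eval_add, eval_one, eval_pow, Real.norm_eq_abs]
  nlinarith [sq_nonneg (|p.eval x| - 1), sq_abs (p.eval x), sq_nonneg (p.eval x)]

lemma le_integral_eval {L : ℝ[X] →ₗ[ℝ] ℝ} {Λ : C_c(ℝ, ℝ) →ₗ[ℝ] ℝ}
    (hΛ : ∀ (g : C_c(ℝ, ℝ)) (p : ℝ[X]), (∀ x, 0 ≤ g x + p.eval x) → 0 ≤ Λ g + L p)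
    {μ : Measure ℝ} [IsFiniteMeasureOnCompacts μ] (hμ : ∀ g : C_c(ℝ, ℝ), ∫ x, g x ∂μ = Λ g)
    (p : ℝ[X]) : L p ≤ ∫ x, p.eval x ∂μ := by
  have hlim : Tendsto (fun n => ∫ x, truncatedPolynomial p n x ∂μ) atTop
      (𝓝 (∫ x, p.eval x ∂μ)) :=
    tendsto_integral_of_dominated_convergence (fun x => ‖p.eval x‖)
      (fun n => (truncatedPolynomial p n).continuous.aestronglyMeasurable)
      (integrable_eval hΛ hμ p).norm
      (fun n => Eventually.of_forall (norm_truncatedPolynomial_le p n))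
      (Eventually.of_forall (tendsto_truncatedPolynomial p))
  have hlim' : Tendsto (fun n : ℕ => ∫ x, truncatedPolynomial p n x ∂μ +
      (n : ℝ)⁻¹ * L (X ^ 2 + p ^ 2)) atTop (𝓝 (∫ x, p.eval x ∂μ)) := by
    simpa only [zero_mul, add_zero] using
      hlim.add (tendsto_inv_atTop_nhds_zero_nat.mul_const (L (X ^ 2 + p ^ 2)))
  refine ge_of_tendsto hlim' ?_
  filter_upwards [eventually_gt_atTop 0] with n hn
  have := hΛ (truncatedPolynomial p n) ((n : ℝ)⁻¹ • (X ^ 2 + p ^ 2) - p) fun x => by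
    have := eval_le_truncatedPolynomial_add p hn x
    simp only [eval_sub, eval_smul, eval_add, eval_pow, eval_X, smul_eq_mul]
    linarith
  rw [map_sub, map_smul, smul_eq_mul] at this
  rw [hμ]
  linarith

/-- If a linear functional `L : ℝ[x] → ℝ` satisfies `L(f) ≥ 0` for
every polynomial `f` nonnegative on `ℝ`, then `L` is represented by a Borel
measure `μ` on `ℝ`: every monomial `x ↦ xⁿ` is `μ`-integrable with
`L(xⁿ) = ∫ xⁿ dμ`, and consequently `L(f) = ∫ f dμ` for every `f ∈ ℝ[x]`. -/
theorem stmt_9 (L : Polynomial ℝ →ₗ[ℝ] ℝ)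
    (hL : ∀ f : Polynomial ℝ, (∀ a : ℝ, 0 ≤ f.eval a) → 0 ≤ L f) :
    ∃ μ : Measure ℝ,
      (∀ n : ℕ, Integrable (fun x : ℝ => x ^ n) μ ∧
        L (Polynomial.X ^ n) = ∫ x, x ^ n ∂μ) ∧
      (∀ f : Polynomial ℝ, L f = ∫ x, f.eval x ∂μ) := by
  obtain ⟨Λ, hΛ⟩ := exists_positive_extension L hL
  let Λ' : C_c(ℝ, ℝ) →ₚ[ℝ] ℝ := PositiveLinearMap.mk₀ Λ fun g hg => by
    simpa using hΛ g 0 fun x => by simpa using! hg x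
  let μ := RealRMK.rieszMeasure Λ'
  have hμ (g : C_c(ℝ, ℝ)) : ∫ x, g x ∂μ = Λ g := RealRMK.integral_rieszMeasure Λ' g
  have hrep (f : ℝ[X]) : L f = ∫ x, f.eval x ∂μ := by
    refine le_antisymm (le_integral_eval hΛ hμ f) ?_
    have := le_integral_eval hΛ hμ (-f)
    simp only [map_neg, eval_neg, integral_neg] at this
    linarith
  refine ⟨μ, fun n => ⟨?_, ?_⟩, hrep⟩
  · simpa using integrable_eval hΛ hμ (X ^ n)
  · simpa using hrep (X ^ n)
end

section
/- (Hamburger's moment theorem.) Let s : ℕ → ℝ be a sequence of real numbers. Then there exists a Borel measure μ on ℝ such that for every k ∈ ℕ the function x ↦ x^k is μ-integrable and s(k) = ∫_ℝ x^k dμ(x), if and only if for every N ∈ ℕ and all real numbers c_0, …, c_N one has ∑_{k=0}^{N} ∑_{l=0}^{N} s(k+l) · c_k · c_l ≥ 0. -/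
open MeasureTheory Finset

namespace Hamburger

open Polynomial Filter Topology

/-- A real polynomial vanishing at a point where it attains its minimum has a double root there. -/
lemma sq_dvd_of_nonneg_of_root {p : ℝ[X]} (hp : ∀ x, 0 ≤ p.eval x) {a : ℝ} (ha : p.eval a = 0) :
    (X - C a) ^ 2 ∣ p := by
  rcases eq_or_ne p 0 with rfl | h0
  · exact dvd_zero _
  have hmin : IsLocalMin (fun x => p.eval x) a :=
    Eventually.of_forall fun x => by simpa [ha] using hp x
  have hd : p.derivative.IsRoot a := by
    simpa [IsRoot, Polynomial.deriv] using hmin.deriv_eq_zero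
  exact (le_rootMultiplicity_iff h0).1 ((one_lt_rootMultiplicity_iff_isRoot h0).2 ⟨ha, hd⟩)

/-- Cancelling a squared linear factor preserves nonnegativity. -/
lemma nonneg_of_sq_mul_nonneg {q : ℝ[X]} {a : ℝ}
    (h : ∀ x, 0 ≤ ((X - C a) ^ 2 * q).eval x) (x : ℝ) : 0 ≤ q.eval x := by
  have hcl : IsClosed {x | 0 ≤ q.eval x} := isClosed_le continuous_const q.continuous
  have hsub : ({a}ᶜ : Set ℝ) ⊆ {x | 0 ≤ q.eval x} := fun y hy => by
    have hy' : 0 < (y - a) ^ 2 := by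
      have : y - a ≠ 0 := sub_ne_zero.2 hy
      positivity
    have := h y
    simp only [eval_mul, eval_pow, eval_sub, eval_X, eval_C] at this
    exact nonneg_of_mul_nonneg_right this hy'
  exact hcl.closure_subset_iff.2 hsub (dense_compl_singleton a x)

/-- A linear functional nonnegative on squares is nonnegative on `r ^ 2 * p` whenever `p` is
pointwise nonnegative. -/
lemma map_sq_mul_nonneg {L : ℝ[X] →ₗ[ℝ] ℝ} (hL : ∀ r, 0 ≤ L (r ^ 2)) (n : ℕ) :
    ∀ p : ℝ[X], p.natDegree ≤ n → (∀ x, 0 ≤ p.eval x) → ∀ r, 0 ≤ L (r ^ 2 * p) := by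
  have hconst (m : ℝ) (hm : 0 ≤ m) (r : ℝ[X]) : 0 ≤ L (r ^ 2 * C m) := by
    have : r ^ 2 * C m = m • r ^ 2 := by rw [smul_eq_C_mul, mul_comm]
    rw [this, map_smul]
    exact mul_nonneg hm (hL r)
  induction n with
  | zero =>
    intro p hn hp r
    rw [eq_C_of_natDegree_le_zero hn] at hp ⊢
    exact hconst _ (by simpa using hp 0) r
  | succ n ih =>
    intro p hn hp r
    rcases Nat.eq_zero_or_pos p.natDegree with h0 | hpos
    · exact ih p (by omega) hp r
    have hlim : Tendsto (fun x : ℝ => p.eval x) (cocompact ℝ) atTop := by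
      have := p.tendsto_norm_atTop (natDegree_pos_iff_degree_pos.1 hpos)
        (tendsto_norm_cocompact_atTop (E := ℝ))
      simpa only [Real.norm_eq_abs, abs_of_nonneg (hp _)] using this
    obtain ⟨a, ha⟩ := p.continuous.exists_forall_le hlim
    have hnn (x : ℝ) : 0 ≤ (p - C (p.eval a)).eval x := by simpa using ha x
    obtain ⟨q, hq⟩ := sq_dvd_of_nonneg_of_root (a := a) hnn (by simp)
    have hq_nonneg := nonneg_of_sq_mul_nonneg (q := q) (a := a) (hq ▸ hnn)
    have hq_deg : q.natDegree ≤ n := by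
      rcases eq_or_ne q 0 with rfl | hq0
      · simp
      have hdeg := congrArg natDegree hq
      rw [natDegree_sub_C, ((monic_X_sub_C a).pow 2).natDegree_mul' hq0,
        (monic_X_sub_C a).natDegree_pow, natDegree_X_sub_C] at hdeg
      omega
    have hp_eq : r ^ 2 * p = (r * (X - C a)) ^ 2 * q + r ^ 2 * C (p.eval a) := by
      linear_combination r ^ 2 * hq
    rw [hp_eq, map_add]
    exact add_nonneg (ih q hq_deg hq_nonneg _) (hconst _ (hp a) r)

/-- A linear functional nonnegative on squares is nonnegative on pointwise nonnegative
polynomials. -/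
lemma map_nonneg_of_sq {L : ℝ[X] →ₗ[ℝ] ℝ} (hL : ∀ r, 0 ≤ L (r ^ 2)) {p : ℝ[X]}
    (hp : ∀ x, 0 ≤ p.eval x) : 0 ≤ L p := by
  simpa using map_sq_mul_nonneg hL p.natDegree p le_rfl hp 1

/-- Continuous functions on `ℝ` dominated in absolute value by a polynomial. -/
def polyBounded : Submodule ℝ C(ℝ, ℝ) where
  carrier := {f | ∃ p : ℝ[X], ∀ x, |f x| ≤ p.eval x}
  zero_mem' := ⟨0, by simp⟩
  add_mem' := by
    rintro f g ⟨p, hp⟩ ⟨q, hq⟩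
    refine ⟨p + q, fun x => ?_⟩
    rw [eval_add]
    exact (abs_add_le _ _).trans (add_le_add (hp x) (hq x))
  smul_mem' := by
    rintro c f ⟨p, hp⟩
    refine ⟨C |c| * p, fun x => ?_⟩
    simpa [abs_mul] using mul_le_mul_of_nonneg_left (hp x) (abs_nonneg c)

lemma abs_le_one_add_sq (y : ℝ) : |y| ≤ 1 + y ^ 2 := by
  rw [← sq_abs]
  nlinarith [sq_nonneg (|y| - 1), abs_nonneg y]

/-- Polynomials as polynomially bounded continuous functions. -/
noncomputable def ofPoly : ℝ[X] →ₗ[ℝ] polyBounded :=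
  LinearMap.codRestrict polyBounded (toContinuousMapAlgHom (R := ℝ)).toLinearMap fun p =>
    ⟨1 + p ^ 2, fun x => by simpa using abs_le_one_add_sq (p.eval x)⟩

lemma ofPoly_apply (p : ℝ[X]) (x : ℝ) : (ofPoly p : C(ℝ, ℝ)) x = p.eval x := rfl

lemma ofPoly_injective : Function.Injective ofPoly := fun p q h =>
  Polynomial.funext fun x => by rw [← ofPoly_apply, h, ofPoly_apply]

/-- Compactly supported continuous functions as polynomially bounded continuous functions. -/
noncomputable def ofCompactSupport : CompactlySupportedContinuousMap ℝ ℝ →ₗ[ℝ] polyBounded where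
  toFun f := ⟨f.toContinuousMap, by
    obtain ⟨c, hc⟩ := f.hasCompactSupport.exists_bound_of_continuous f.continuous
    exact ⟨C c, fun x => by simpa using hc x⟩⟩
  map_add' _ _ := rfl
  map_smul' _ _ := rfl

lemma ofCompactSupport_apply (f : CompactlySupportedContinuousMap ℝ ℝ) (x : ℝ) :
    (ofCompactSupport f : C(ℝ, ℝ)) x = f x := rfl

/-- The cone of pointwise nonnegative polynomially bounded continuous functions. -/
def nonnegCone : PointedCone ℝ polyBounded where
  carrier := {f | ∀ x, 0 ≤ (f : C(ℝ, ℝ)) x}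
  zero_mem' _ := le_rfl
  add_mem' hf hg x := add_nonneg (hf x) (hg x)
  smul_mem' c _ hf x := mul_nonneg c.2 (hf x)

/-- A functional nonnegative on nonnegative polynomials extends to a positive functional on
polynomially bounded continuous functions. -/
lemma exists_extension {L : ℝ[X] →ₗ[ℝ] ℝ} (hL : ∀ p : ℝ[X], (∀ x, 0 ≤ p.eval x) → 0 ≤ L p) :
    ∃ g : polyBounded →ₗ[ℝ] ℝ, (∀ p, g (ofPoly p) = L p) ∧
      ∀ f : polyBounded, (∀ x, 0 ≤ (f : C(ℝ, ℝ)) x) → 0 ≤ g f := by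
  let e := LinearEquiv.ofInjective ofPoly ofPoly_injective
  let F : polyBounded →ₗ.[ℝ] ℝ := ⟨LinearMap.range ofPoly, L ∘ₗ e.symm.toLinearMap⟩
  have hF (p : ℝ[X]) : F (e p) = L p := congrArg L (e.symm_apply_apply p)
  obtain ⟨g, hg, hg_nonneg⟩ := riesz_extension nonnegCone F
    (fun f hf => by
      obtain ⟨p, rfl⟩ := e.surjective f
      rw [hF]
      exact hL p hf)
    (fun f => by
      obtain ⟨p, hp⟩ := f.2
      exact ⟨e p, fun x => neg_le_iff_add_nonneg.1 ((neg_le_abs _).trans (hp x))⟩)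
  exact ⟨g, fun p => (hg (e p)).trans (hF p), hg_nonneg⟩

/-- A continuous function equal to `1` on `[-n, n]` and to `0` outside `[-n - 1, n + 1]`. -/
noncomputable def cutoff (n : ℕ) (x : ℝ) : ℝ := max 0 (min 1 (n + 1 - |x|))

lemma cutoff_nonneg (n : ℕ) (x : ℝ) : 0 ≤ cutoff n x := le_max_left _ _

lemma cutoff_le_one (n : ℕ) (x : ℝ) : cutoff n x ≤ 1 := max_le zero_le_one (min_le_left _ _)

lemma cutoff_eq_one {n : ℕ} {x : ℝ} (h : |x| ≤ n) : cutoff n x = 1 := by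
  rw [cutoff, min_eq_left (by linarith), max_eq_right zero_le_one]

lemma cutoff_eq_zero {n : ℕ} {x : ℝ} (h : n + 1 ≤ |x|) : cutoff n x = 0 :=
  max_eq_left ((min_le_right _ _).trans (by linarith))

lemma one_sub_cutoff_mul_le (n : ℕ) (x : ℝ) : (1 - cutoff n x) * n ≤ |x| := by
  rcases le_total |x| n with h | h
  · simp [cutoff_eq_one h]
  · nlinarith [cutoff_nonneg n x, Nat.cast_nonneg (α := ℝ) n]

/-- The product of a polynomial and a cutoff function. -/
noncomputable def cutoffMul (n : ℕ) (p : ℝ[X]) : CompactlySupportedContinuousMap ℝ ℝ where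
  toFun x := cutoff n x * p.eval x
  continuous_toFun := by
    unfold cutoff
    fun_prop
  hasCompactSupport' := HasCompactSupport.intro (isCompact_Icc (a := -((n : ℝ) + 1)) (b := n + 1))
    fun x hx => by
      rw [cutoff_eq_zero, zero_mul]
      by_contra! h
      exact hx (abs_le.1 h.le)

lemma cutoffMul_apply (n : ℕ) (p : ℝ[X]) (x : ℝ) : cutoffMul n p x = cutoff n x * p.eval x := rfl

lemma tendsto_cutoffMul (p : ℝ[X]) (x : ℝ) :
    Tendsto (fun n => cutoffMul n p x) atTop (𝓝 (p.eval x)) := by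
  obtain ⟨m, hm⟩ := exists_nat_ge |x|
  refine tendsto_const_nhds.congr' ?_
  filter_upwards [eventually_ge_atTop m] with n hn
  rw [cutoffMul_apply, cutoff_eq_one (hm.trans (by exact_mod_cast hn)), one_mul]

/-- Haviland's theorem on the line: a linear functional which is nonnegative on nonnegative
polynomials is integration against a measure. -/
theorem exists_measure_of_nonneg {L : ℝ[X] →ₗ[ℝ] ℝ}
    (hL : ∀ p : ℝ[X], (∀ x, 0 ≤ p.eval x) → 0 ≤ L p) :
    ∃ μ : Measure ℝ, ∀ p : ℝ[X], Integrable (fun x => p.eval x) μ ∧ L p = ∫ x, p.eval x ∂μ := by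
  obtain ⟨g, hgL, hg⟩ := exists_extension hL
  have hg_mono (f₁ f₂ : polyBounded) (h : ∀ x, (f₁ : C(ℝ, ℝ)) x ≤ (f₂ : C(ℝ, ℝ)) x) :
      g f₁ ≤ g f₂ := by
    rw [← sub_nonneg, ← map_sub]
    exact hg _ fun x => sub_nonneg.2 (h x)
  let Λ : CompactlySupportedContinuousMap ℝ ℝ →ₚ[ℝ] ℝ :=
    PositiveLinearMap.mk₀ (g ∘ₗ ofCompactSupport) fun f hf => hg _ fun x => hf x
  let μ := RealRMK.rieszMeasure Λ
  have : IsFiniteMeasureOnCompacts μ := by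
    dsimp only [μ, RealRMK.rieszMeasure]
    infer_instance
  have hΛ (f : CompactlySupportedContinuousMap ℝ ℝ) : ∫ x, f x ∂μ = g (ofCompactSupport f) :=
    RealRMK.integral_rieszMeasure Λ f
  have hint_nonneg (p : ℝ[X]) (hp : ∀ x, 0 ≤ p.eval x) : Integrable (fun x => p.eval x) μ := by
    have hcover : AECover μ atTop fun n : ℕ => Set.Icc (-(n : ℝ)) n :=
      aecover_Icc (tendsto_neg_atTop_atBot.comp tendsto_natCast_atTop_atTop)
        tendsto_natCast_atTop_atTop
    refine hcover.integrable_of_integral_bounded_of_nonneg_ae (L p)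
      (fun n => p.continuous.continuousOn.integrableOn_compact isCompact_Icc)
      (Eventually.of_forall hp) (Eventually.of_forall fun n => ?_)
    calc ∫ x in Set.Icc (-(n : ℝ)) n, p.eval x ∂μ
        = ∫ x in Set.Icc (-(n : ℝ)) n, cutoffMul n p x ∂μ :=
          setIntegral_congr_fun measurableSet_Icc fun x hx => by
            simp only [cutoffMul_apply, cutoff_eq_one (abs_le.2 hx), one_mul]
      _ ≤ ∫ x, cutoffMul n p x ∂μ :=
          setIntegral_le_integral (cutoffMul n p).integrable
            (Eventually.of_forall fun x => mul_nonneg (cutoff_nonneg n x) (hp x))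
      _ = g (ofCompactSupport (cutoffMul n p)) := hΛ _
      _ ≤ g (ofPoly p) := hg_mono _ _ fun x =>
          mul_le_of_le_one_left (hp x) (cutoff_le_one n x)
      _ = L p := hgL p
  have hint (p : ℝ[X]) : Integrable (fun x => p.eval x) μ := by
    refine (hint_nonneg (1 + p ^ 2) fun x => ?_).mono' p.continuous.aestronglyMeasurable
      (Eventually.of_forall fun x => ?_)
    · simp only [eval_add, eval_one, eval_pow]
      positivity
    · simpa using abs_le_one_add_sq (p.eval x)
  refine ⟨μ, fun p => ⟨hint p, ?_⟩⟩
  have hlim_int : Tendsto (fun n => ∫ x, cutoffMul n p x ∂μ) atTop (𝓝 (∫ x, p.eval x ∂μ)) := by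
    refine tendsto_integral_of_dominated_convergence (fun x => |p.eval x|)
      (fun n => (cutoffMul n p).continuous.aestronglyMeasurable) (hint p).abs
      (fun n => Eventually.of_forall fun x => ?_)
      (Eventually.of_forall (tendsto_cutoffMul p))
    rw [cutoffMul_apply, norm_mul, Real.norm_eq_abs, Real.norm_eq_abs,
      abs_of_nonneg (cutoff_nonneg n x)]
    exact mul_le_of_le_one_left (abs_nonneg _) (cutoff_le_one n x)
  let q : ℝ[X] := 1 + (X * p) ^ 2
  have herr (n : ℕ) (x : ℝ) : |p.eval x - cutoffMul n p x| * n ≤ q.eval x := by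
    have h1 : p.eval x - cutoffMul n p x = (1 - cutoff n x) * p.eval x := by
      rw [cutoffMul_apply]
      ring
    have hq : q.eval x = 1 + (x * p.eval x) ^ 2 := by simp [q]
    rw [h1, abs_mul, abs_of_nonneg (sub_nonneg.2 (cutoff_le_one n x)), hq, mul_right_comm]
    calc (1 - cutoff n x) * n * |p.eval x| ≤ |x| * |p.eval x| :=
          mul_le_mul_of_nonneg_right (one_sub_cutoff_mul_le n x) (abs_nonneg _)
      _ = |x * p.eval x| := (abs_mul _ _).symm
      _ ≤ _ := abs_le_one_add_sq _
  have hlim_L : Tendsto (fun n => ∫ x, cutoffMul n p x ∂μ) atTop (𝓝 (L p)) := by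
    rw [tendsto_iff_dist_tendsto_zero]
    refine squeeze_zero' (Eventually.of_forall fun _ => dist_nonneg) ?_
      (tendsto_const_div_atTop_nhds_zero_nat (L q))
    filter_upwards [eventually_gt_atTop 0] with n hn
    have hn' : (0 : ℝ) < n := by exact_mod_cast hn
    rw [dist_comm, Real.dist_eq, hΛ, ← hgL p, ← map_sub, le_div_iff₀ hn', ← hgL q]
    set d := ofPoly p - ofCompactSupport (cutoffMul n p)
    have hpos : n * g d ≤ g (ofPoly q) := by
      rw [← smul_eq_mul, ← map_smul]
      refine hg_mono _ _ fun x => ?_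
      change (n : ℝ) * (p.eval x - cutoffMul n p x) ≤ q.eval x
      rw [mul_comm]
      exact (mul_le_mul_of_nonneg_right (le_abs_self _) hn'.le).trans (herr n x)
    have hneg : -n * g d ≤ g (ofPoly q) := by
      rw [← smul_eq_mul, ← map_smul]
      refine hg_mono _ _ fun x => ?_
      change -(n : ℝ) * (p.eval x - cutoffMul n p x) ≤ q.eval x
      rw [neg_mul_comm, mul_comm]
      exact (mul_le_mul_of_nonneg_right (neg_le_abs _) hn'.le).trans (herr n x)
    rcases abs_cases (g d) with ⟨h, -⟩ | ⟨h, -⟩ <;> rw [h] <;> linarith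
  exact tendsto_nhds_unique hlim_L hlim_int

/-- The linear functional on polynomials sending `X ^ k` to `s k`. -/
noncomputable def momentFunctional (s : ℕ → ℝ) : ℝ[X] →ₗ[ℝ] ℝ :=
  lsum fun k => s k • LinearMap.id

lemma momentFunctional_monomial (s : ℕ → ℝ) (k : ℕ) (a : ℝ) :
    momentFunctional s (monomial k a) = s k * a := by
  change (monomial k a).sum (fun k a => s k * a) = _
  exact sum_monomial_index a _ (mul_zero _)

lemma momentFunctional_sq (s : ℕ → ℝ) (r : ℝ[X]) :
    momentFunctional s (r ^ 2) = ∑ k ∈ range (r.natDegree + 1), ∑ l ∈ range (r.natDegree + 1),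
      s (k + l) * r.coeff k * r.coeff l := by
  conv_lhs => rw [r.as_sum_range, sq, sum_mul_sum]
  simp only [map_sum, monomial_mul_monomial, momentFunctional_monomial, mul_assoc]

end Hamburger

/-- Hamburger's moment theorem: A sequence `s : ℕ → ℝ` is the
moment sequence of some Borel measure `μ` on `ℝ` (with all monomials
`μ`-integrable) if and only if `∑_{k,l=0}^{N} s(k+l) c_k c_l ≥ 0` for every
`N ∈ ℕ` and all reals `c_0, …, c_N`. -/
theorem stmt_11 (s : ℕ → ℝ) :
    (∃ μ : Measure ℝ, ∀ k : ℕ,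
      Integrable (fun x : ℝ => x ^ k) μ ∧ s k = ∫ x, x ^ k ∂μ) ↔
    (∀ (N : ℕ) (c : ℕ → ℝ),
      0 ≤ ∑ k ∈ range (N + 1), ∑ l ∈ range (N + 1), s (k + l) * c k * c l) := by
  constructor
  · rintro ⟨μ, hμ⟩ N c
    have hint (k l : ℕ) : Integrable (fun x : ℝ => x ^ (k + l) * c k * c l) μ :=
      ((hμ (k + l)).1.mul_const _).mul_const _
    have heq : ∑ k ∈ range (N + 1), ∑ l ∈ range (N + 1), s (k + l) * c k * c l =
        ∫ x, (∑ k ∈ range (N + 1), c k * x ^ k) ^ 2 ∂μ := by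
      simp_rw [(hμ _).2, ← integral_mul_const]
      simp_rw [← integral_finsetSum _ fun l _ => hint _ l]
      rw [← integral_finsetSum _ fun k _ => integrable_finsetSum _ fun l _ => hint k l]
      refine integral_congr_ae (Filter.Eventually.of_forall fun x => ?_)
      simp only [sq, sum_mul_sum]
      exact sum_congr rfl fun k _ => sum_congr rfl fun l _ => by ring
    rw [heq]
    exact integral_nonneg fun x => sq_nonneg _
  · intro h
    obtain ⟨μ, hμ⟩ := Hamburger.exists_measure_of_nonneg (L := Hamburger.momentFunctional s)
      fun p hp => Hamburger.map_nonneg_of_sq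
        (fun r => by rw [Hamburger.momentFunctional_sq]; exact h _ _) hp
    refine ⟨μ, fun k => ?_⟩
    have := hμ (Polynomial.monomial k 1)
    simpa [Hamburger.momentFunctional_monomial] using this
end
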